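/- (Delta hedging replicates European options in the Black–Scholes model, pathwise.) Let T > 0, σ > 0, and let π = (π_N) be a sequence of partitions of [0,T] with mesh tending to 0. Let X : [0,T] → ℝ be a continuous path whose quadratic variation along π is [X]_t = ∫_0^t σ² X_s² ds for all t ∈ [0,T]. Let F : [0,T] × ℝ → ℝ be three times continuously differentiable on a neighbourhood of the path {(t, X_t) : t ∈ [0,T]} and satisfy the Black–Scholes PDE with zero interest rate ∂F/∂t (t, s) + (1/2) σ² s² ∂²F/∂s² (t, s) = 0 on this neighbourhood. Then F(T, X_T) = F(0, X_0) + lim_{N→∞} Σ_{[u,v]∈π_N} ∂F/∂s (u, X_u) · (X_v − X_u). -/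

import Mathlib

open Filter Topology

/-- A sequence of partitions of `[0, T]` with mesh tending to zero.
For each `N`, the partition `π_N` has points `t N 0 = 0 < t N 1 < ⋯ < t N (c N) = T`. -/
structure PartitionSeq (T : ℝ) : Type where
  c : ℕ → ℕ
  t : ℕ → ℕ → ℝ
  c_pos : ∀ N, 0 < c N
  first : ∀ N, t N 0 = 0
  last : ∀ N, t N (c N) = T
  mono : ∀ N, ∀ i < c N, t N i < t N (i + 1)
  mesh_to_zero : ∀ ε > 0, ∃ M : ℕ, ∀ N ≥ M, ∀ i < c N, t N (i + 1) - t N i < ε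

/-- A path `X` has vanishing `p`-th variation along the partition sequence `π` if
`Σ_{[u,v] ∈ π_N} ‖X_v - X_u‖^p → 0` as `N → ∞`. -/
def VanishingVariation {V : Type*} [NormedAddCommGroup V] {T : ℝ}
    (π : PartitionSeq T) (p : ℝ) (X : ℝ → V) : Prop :=
  Tendsto (fun N => ∑ i ∈ Finset.range (π.c N),
    ‖X (π.t N (i + 1)) - X (π.t N i)‖ ^ p) atTop (nhds 0)

open Set

namespace PartitionSeq

variable {T : ℝ} (π : PartitionSeq T)

lemma t_le_t {N i j : ℕ} (hij : i ≤ j) (hj : j ≤ π.c N) : π.t N i ≤ π.t N j := by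
  induction j, hij using Nat.le_induction with
  | base => exact le_rfl
  | succ k _ ih => exact (ih (by omega)).trans (π.mono N k (by omega)).le

lemma t_mem {N i : ℕ} (hi : i ≤ π.c N) : π.t N i ∈ Icc (0 : ℝ) T :=
  ⟨(π.first N).ge.trans (π.t_le_t (Nat.zero_le i) hi), (π.t_le_t hi le_rfl).trans (π.last N).le⟩

lemma sum_range_sub (N : ℕ) (Q : ℝ → ℝ) :
    ∑ i ∈ Finset.range (π.c N), (Q (π.t N (i + 1)) - Q (π.t N i)) = Q T - Q 0 := by
  rw [Finset.sum_range_sub (fun i => Q (π.t N i)), π.first, π.last]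

/-- The points of `π_N` up to time `t` are an initial segment whose next point is beyond `t`. -/
lemma exists_filter_eq_range (N : ℕ) {t : ℝ} (ht : t ∈ Icc (0 : ℝ) T) :
    ∃ j < π.c N, (Finset.range (π.c N)).filter (fun i => π.t N i ≤ t) = Finset.range (j + 1) ∧
      π.t N j ≤ t ∧ t ≤ π.t N (j + 1) := by
  by_cases hex : ∃ k, k < π.c N ∧ t < π.t N (k + 1)
  · obtain ⟨hk, htk⟩ := Nat.find_spec hex
    have hmin : ∀ m < Nat.find hex, π.t N (m + 1) ≤ t := fun m hm => by
      have := Nat.find_min hex hm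
      by_contra! h
      exact this ⟨by omega, h⟩
    generalize Nat.find hex = k at hk htk hmin
    have hle : π.t N k ≤ t := by
      rcases k with _ | k
      · rw [π.first]; exact ht.1
      · exact hmin k (Nat.lt_succ_self k)
    refine ⟨k, hk, ?_, hle, htk.le⟩
    ext i
    simp only [Finset.mem_filter, Finset.mem_range]
    refine ⟨fun ⟨hi, hit⟩ => ?_, fun hi => ⟨by omega, (π.t_le_t (by omega) hk.le).trans hle⟩⟩
    by_contra! h
    exact absurd (htk.trans_le (π.t_le_t h hi.le)) hit.not_gt
  · push Not at hex
    have hc := π.c_pos N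
    have hcc : π.c N - 1 + 1 = π.c N := Nat.sub_add_cancel hc
    have hT : T ≤ t := by simpa [hcc, π.last] using hex (π.c N - 1) (by omega)
    refine ⟨π.c N - 1, by omega, ?_, (π.t_mem (by omega)).2.trans hT, ?_⟩
    · rw [hcc]
      exact Finset.filter_true_of_mem fun i hi =>
        (π.t_mem (Finset.mem_range.1 hi).le).2.trans hT
    · rw [hcc, π.last]; exact ht.2

lemma tendsto_sum_filter_sub {Q : ℝ → ℝ} (hQ : ContinuousOn Q (Icc 0 T)) {t : ℝ}
    (ht : t ∈ Icc (0 : ℝ) T) :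
    Tendsto (fun N => ∑ i ∈ (Finset.range (π.c N)).filter (fun i => π.t N i ≤ t),
      (Q (π.t N (i + 1)) - Q (π.t N i))) atTop (𝓝 (Q t - Q 0)) := by
  choose j hj hfilter hle hge using fun N => π.exists_filter_eq_range N ht
  have hlim : Tendsto (fun N => π.t N (j N + 1)) atTop (𝓝 t) := by
    rw [Metric.tendsto_atTop]
    intro ε hε
    obtain ⟨M, hM⟩ := π.mesh_to_zero ε hε
    refine ⟨M, fun N hN => ?_⟩
    rw [Real.dist_eq, abs_of_nonneg (by linarith [hge N])]
    linarith [hM N hN (j N) (hj N), hle N]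
  have hlim' : Tendsto (fun N => π.t N (j N + 1)) atTop (𝓝[Icc 0 T] t) :=
    tendsto_nhdsWithin_iff.2 ⟨hlim, Eventually.of_forall fun N => π.t_mem (hj N)⟩
  refine (((hQ t ht).tendsto.comp hlim').sub_const (Q 0)).congr fun N => ?_
  rw [hfilter, Finset.sum_range_sub (fun i => Q (π.t N i)), π.first]
  rfl

/-- Sums of local errors that are small relative to weights of bounded total mass vanish. -/
lemma tendsto_sum_of_le_mul {r w : ℝ → ℝ → ℝ}
    (hr : ∀ ε > 0, ∃ δ > 0, ∀ u ∈ Icc (0 : ℝ) T, ∀ v ∈ Icc (0 : ℝ) T, u ≤ v → v - u < δ →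
      |r u v| ≤ ε * w u v) {K : ℝ}
    (hK : ∀ᶠ N in atTop, ∑ i ∈ Finset.range (π.c N), w (π.t N i) (π.t N (i + 1)) ≤ K) :
    Tendsto (fun N => ∑ i ∈ Finset.range (π.c N), r (π.t N i) (π.t N (i + 1))) atTop (𝓝 0) := by
  rw [Metric.tendsto_nhds]
  intro ε hε
  obtain ⟨δ, hδ, hrδ⟩ := hr (ε / (|K| + 1)) (by positivity)
  obtain ⟨M, hM⟩ := π.mesh_to_zero δ hδ
  filter_upwards [hK, eventually_ge_atTop M] with N hKN hN
  rw [dist_zero_right, Real.norm_eq_abs]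
  calc |∑ i ∈ Finset.range (π.c N), r (π.t N i) (π.t N (i + 1))|
      ≤ ∑ i ∈ Finset.range (π.c N), |r (π.t N i) (π.t N (i + 1))| :=
        Finset.abs_sum_le_sum_abs _ _
    _ ≤ ∑ i ∈ Finset.range (π.c N), ε / (|K| + 1) * w (π.t N i) (π.t N (i + 1)) := by
        refine Finset.sum_le_sum fun i hi => ?_
        have hi := Finset.mem_range.1 hi
        exact hrδ _ (π.t_mem hi.le) _ (π.t_mem hi) (π.mono N i hi).le (hM N hN i hi)
    _ ≤ ε / (|K| + 1) * |K| := by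
        rw [← Finset.mul_sum]
        exact mul_le_mul_of_nonneg_left (hKN.trans (le_abs_self K)) (by positivity)
    _ < ε := by
        rw [div_mul_eq_mul_div, div_lt_iff₀ (by positivity)]
        nlinarith [abs_nonneg K]

end PartitionSeq

/-- A continuous function on `[0, T]` is uniformly close to a combination of indicators of
the intervals `[0, s]`. -/
lemma exists_step_approx {T : ℝ} (hT : 0 < T) {g : ℝ → ℝ} (hg : ContinuousOn g (Icc 0 T))
    {ε : ℝ} (hε : 0 < ε) :
    ∃ (m : ℕ) (b s : ℕ → ℝ), (∀ j ∈ Finset.range m, s j ∈ Icc (0 : ℝ) T) ∧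
      ∀ x ∈ Icc (0 : ℝ) T,
        |g x - ∑ j ∈ Finset.range m, b j * (if x ≤ s j then 1 else 0)| ≤ ε := by
  obtain ⟨δ, hδ, hgδ⟩ := Metric.uniformContinuousOn_iff.1
    (isCompact_Icc.uniformContinuousOn_of_continuous hg) ε hε
  obtain ⟨m, hm⟩ := exists_nat_gt (T / δ)
  have hm0 : (0 : ℝ) < m := (div_pos hT hδ).trans hm
  set s : ℕ → ℝ := fun j => j * (T / m) with hs
  have hmem : ∀ j ≤ m, s j ∈ Icc (0 : ℝ) T := fun j hj => by
    refine ⟨by positivity, ?_⟩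
    have : (j : ℝ) ≤ m := by exact_mod_cast hj
    calc (j : ℝ) * (T / m) ≤ m * (T / m) := by gcongr
      _ = T := by field_simp
  have hsm : s m = T := by simp only [hs]; field_simp
  set G : ℕ → ℝ := fun j => if j ≤ m then g (s j) else 0 with hG
  refine ⟨m + 1, fun j => G j - G (j + 1), s,
    fun j hj => hmem j (Nat.lt_succ_iff.1 (Finset.mem_range.1 hj)), fun x hx => ?_⟩
  set k := ⌈x / (T / m)⌉₊ with hk
  have hle : ∀ j : ℕ, x ≤ s j ↔ k ≤ j := fun j => by
    rw [hk, Nat.ceil_le, div_le_iff₀ (by positivity)]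
  have hkm : k ≤ m := (hle m).1 (hsm ▸ hx.2)
  have hsum : ∑ j ∈ Finset.range (m + 1), (G j - G (j + 1)) * (if x ≤ s j then 1 else 0)
      = g (s k) := by
    simp only [hle, mul_ite, mul_one, mul_zero]
    rw [← Finset.sum_filter]
    have : (Finset.range (m + 1)).filter (fun j => k ≤ j) = Finset.Ico k (m + 1) := by
      ext j; simp [and_comm]
    rw [this, ← neg_inj, ← Finset.sum_neg_distrib]
    simp only [neg_sub]
    rw [Finset.sum_Ico_sub G (by omega)]
    simp [hG, hkm]
  rw [hsum, ← Real.dist_eq]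
  refine (hgδ x hx (s k) (hmem k hkm) ?_).le
  have h1 : x ≤ s k := (hle k).2 le_rfl
  have h2 : s k < x + T / m := by
    have := Nat.ceil_lt_add_one (a := x / (T / m)) (div_nonneg hx.1 (by positivity))
    have h3 : (k : ℝ) * (T / m) < (x / (T / m) + 1) * (T / m) :=
      mul_lt_mul_of_pos_right this (by positivity)
    rwa [add_mul, one_mul, div_mul_cancel₀ _ (by positivity : T / (m : ℝ) ≠ 0)] at h3
  have h4 : T / m < δ := by
    rw [div_lt_iff₀ hm0, mul_comm]
    exact (div_lt_iff₀ hδ).1 hm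
  rw [Real.dist_eq, abs_sub_comm, abs_of_nonneg (by linarith)]
  linarith

/-- Discrete signed measures on the partitions with bounded total variation and vanishing
distribution functions converge weakly to zero. -/
lemma PartitionSeq.tendsto_sum_mul_of_tendsto_sum_filter {T : ℝ} (hT : 0 < T)
    (π : PartitionSeq T) {a : ℕ → ℕ → ℝ}
    (ha : ∀ t ∈ Icc (0 : ℝ) T,
      Tendsto (fun N => ∑ i ∈ (Finset.range (π.c N)).filter (fun i => π.t N i ≤ t), a N i)
        atTop (𝓝 0)) {K : ℝ}
    (hK : ∀ᶠ N in atTop, ∑ i ∈ Finset.range (π.c N), |a N i| ≤ K)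
    {g : ℝ → ℝ} (hg : ContinuousOn g (Icc 0 T)) :
    Tendsto (fun N => ∑ i ∈ Finset.range (π.c N), g (π.t N i) * a N i) atTop (𝓝 0) := by
  rw [Metric.tendsto_nhds]
  intro ε hε
  set η := ε / (2 * (|K| + 1)) with hη
  have hη0 : 0 < η := by positivity
  obtain ⟨m, b, s, hs, happ⟩ := exists_step_approx hT hg hη0
  set h : ℝ → ℝ := fun x => ∑ j ∈ Finset.range m, b j * (if x ≤ s j then 1 else 0) with hh
  have hstep : Tendsto (fun N => ∑ i ∈ Finset.range (π.c N), h (π.t N i) * a N i)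
      atTop (𝓝 0) := by
    have := tendsto_finsetSum (Finset.range m) fun j hj => (ha (s j) (hs j hj)).const_mul (b j)
    simp only [mul_zero, Finset.sum_const_zero] at this
    refine this.congr fun N => ?_
    simp only [hh, Finset.sum_mul]
    rw [Finset.sum_comm]
    refine Finset.sum_congr rfl fun j _ => ?_
    rw [Finset.sum_filter, Finset.mul_sum]
    refine Finset.sum_congr rfl fun i _ => ?_
    split_ifs <;> simp
  filter_upwards [hK, Metric.tendsto_nhds.1 hstep (ε / 2) (by positivity)] with N hKN hN
  rw [dist_zero_right, Real.norm_eq_abs] at hN ⊢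
  have hdiff : |∑ i ∈ Finset.range (π.c N), (g (π.t N i) - h (π.t N i)) * a N i| ≤ η * |K| :=
    calc _ ≤ ∑ i ∈ Finset.range (π.c N), |(g (π.t N i) - h (π.t N i)) * a N i| :=
          Finset.abs_sum_le_sum_abs _ _
      _ ≤ ∑ i ∈ Finset.range (π.c N), η * |a N i| := by
          refine Finset.sum_le_sum fun i hi => ?_
          rw [abs_mul]
          exact mul_le_mul_of_nonneg_right
            (happ _ (π.t_mem (Finset.mem_range.1 hi).le)) (abs_nonneg _)
      _ ≤ η * |K| := by
          rw [← Finset.mul_sum]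
          exact mul_le_mul_of_nonneg_left (hKN.trans (le_abs_self K)) hη0.le
  have hηK : η * |K| ≤ ε / 2 := by
    rw [hη, div_mul_eq_mul_div, div_le_iff₀ (by positivity)]
    nlinarith [abs_nonneg K]
  have hsplit : ∑ i ∈ Finset.range (π.c N), g (π.t N i) * a N i =
      ∑ i ∈ Finset.range (π.c N), (g (π.t N i) - h (π.t N i)) * a N i +
        ∑ i ∈ Finset.range (π.c N), h (π.t N i) * a N i := by
    rw [← Finset.sum_add_distrib]
    exact Finset.sum_congr rfl fun i _ => by ring
  rw [hsplit]
  linarith [abs_add_le (∑ i ∈ Finset.range (π.c N), (g (π.t N i) - h (π.t N i)) * a N i)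
    (∑ i ∈ Finset.range (π.c N), h (π.t N i) * a N i)]

/-- A Taylor bound of first order in time and second order in space, in terms of the
oscillation `ε` of the top derivatives on the box between the two points. -/
lemma abs_taylor_time_space_le {F : ℝ × ℝ → ℝ} {B : ℝ × ℝ → ℝ} {u v x y A C ε : ℝ}
    (hFd : ∀ t ∈ uIcc u v, ∀ s ∈ uIcc x y, DifferentiableAt ℝ F (t, s))
    (hB : ∀ z, B z = fderiv ℝ F z ((0 : ℝ), (1 : ℝ)))
    (hBd : ∀ t ∈ uIcc u v, ∀ s ∈ uIcc x y, DifferentiableAt ℝ B (t, s))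
    (hA : ∀ t ∈ uIcc u v, ∀ s ∈ uIcc x y, |fderiv ℝ F (t, s) ((1 : ℝ), (0 : ℝ)) - A| ≤ ε)
    (hC : ∀ t ∈ uIcc u v, ∀ s ∈ uIcc x y, |fderiv ℝ B (t, s) ((0 : ℝ), (1 : ℝ)) - C| ≤ ε) :
    |F (v, y) - F (u, x) - A * (v - u) - B (u, x) * (y - x) - 1 / 2 * C * (y - x) ^ 2| ≤
      ε * (|v - u| + (y - x) ^ 2) := by
  have hu : u ∈ uIcc u v := left_mem_uIcc
  have hx : x ∈ uIcc x y := left_mem_uIcc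
  have hy : y ∈ uIcc x y := right_mem_uIcc
  have hε : 0 ≤ ε := (abs_nonneg _).trans (hA u hu x hx)
  have hline_t : ∀ t s : ℝ, HasDerivAt (fun t => (t, s)) ((1 : ℝ), (0 : ℝ)) t := fun t s =>
    (hasDerivAt_id t).prodMk (hasDerivAt_const t s)
  have hline_s : ∀ t s : ℝ, HasDerivAt (fun s => (t, s)) ((0 : ℝ), (1 : ℝ)) s := fun t s =>
    (hasDerivAt_const s t).prodMk (hasDerivAt_id s)
  have h1 : |F (v, y) - A * v - (F (u, y) - A * u)| ≤ ε * |v - u| :=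
    (convex_uIcc u v).norm_image_sub_le_of_norm_hasDerivWithin_le
      (f := fun t => F (t, y) - A * t)
      (fun t ht => (((hFd t ht y hy).hasFDerivAt.comp_hasDerivAt t (hline_t t y)).sub
        ((hasDerivAt_id t).const_mul A)).hasDerivWithinAt)
      (fun t ht => by simpa using hA t ht y hy) left_mem_uIcc right_mem_uIcc
  have h2 : ∀ s ∈ uIcc x y, |B (u, s) - B (u, x) - C * (s - x)| ≤ ε * |y - x| := fun s hs => by
    have := (convex_uIcc x y).norm_image_sub_le_of_norm_hasDerivWithin_le
      (f := fun s => B (u, s) - C * s)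
      (fun s hs => (((hBd u hu s hs).hasFDerivAt.comp_hasDerivAt s (hline_s u s)).sub
        ((hasDerivAt_id s).const_mul C)).hasDerivWithinAt)
      (fun s hs => by simpa using hC u hu s hs) hx hs
    calc _ = |B (u, s) - C * s - (B (u, x) - C * x)| := by congr 1; ring
      _ ≤ ε * |s - x| := this
      _ ≤ ε * |y - x| := mul_le_mul_of_nonneg_left (abs_sub_left_of_mem_uIcc hs) hε
  have h3 : |F (u, y) - B (u, x) * y - 1 / 2 * C * (y - x) ^ 2 -
      (F (u, x) - B (u, x) * x - 1 / 2 * C * (x - x) ^ 2)| ≤ ε * |y - x| * |y - x| := by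
    refine (convex_uIcc x y).norm_image_sub_le_of_norm_hasDerivWithin_le
      (f := fun s => F (u, s) - B (u, x) * s - 1 / 2 * C * (s - x) ^ 2)
      (f' := fun s => B (u, s) - B (u, x) - C * (s - x))
      (fun s hs => ?_) h2 hx hy
    have hF := (hFd u hu s hs).hasFDerivAt.comp_hasDerivAt s (hline_s u s)
    rw [← hB] at hF
    refine (((hF.sub ((hasDerivAt_id s).const_mul (B (u, x)))).sub
      ((((hasDerivAt_id s).sub_const x).pow 2).const_mul (1 / 2 * C))).congr_deriv
        ?_).hasDerivWithinAt
    simp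
    ring
  calc _ = |(F (v, y) - A * v - (F (u, y) - A * u)) +
        (F (u, y) - B (u, x) * y - 1 / 2 * C * (y - x) ^ 2 -
          (F (u, x) - B (u, x) * x - 1 / 2 * C * (x - x) ^ 2))| := by congr 1; ring
    _ ≤ ε * |v - u| + ε * |y - x| * |y - x| := (abs_add_le _ _).trans (add_le_add h1 h3)
    _ = ε * (|v - u| + (y - x) ^ 2) := by rw [mul_assoc, abs_mul_abs_self]; ring

/-- The Taylor bound along a continuous path, uniformly in time. -/
lemma exists_taylor_along_path {T : ℝ} {X : ℝ → ℝ} (hXc : ContinuousOn X (Icc 0 T))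
    {F : ℝ × ℝ → ℝ} {U : Set (ℝ × ℝ)} (hU : IsOpen U)
    (hpath : ∀ t ∈ Icc (0 : ℝ) T, (t, X t) ∈ U) (hF : ContDiffOn ℝ 2 F U)
    {B : ℝ × ℝ → ℝ} (hB : ∀ z, B z = fderiv ℝ F z ((0 : ℝ), (1 : ℝ)))
    {ε : ℝ} (hε : 0 < ε) :
    ∃ δ > 0, ∀ u ∈ Icc (0 : ℝ) T, ∀ v ∈ Icc (0 : ℝ) T, u ≤ v → v - u < δ →
      |F (v, X v) - F (u, X u) - fderiv ℝ F (u, X u) ((1 : ℝ), (0 : ℝ)) * (v - u) -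
        B (u, X u) * (X v - X u) -
        1 / 2 * fderiv ℝ B (u, X u) ((0 : ℝ), (1 : ℝ)) * (X v - X u) ^ 2| ≤
      ε * ((v - u) + (X v - X u) ^ 2) := by
  obtain rfl : B = fun z => fderiv ℝ F z ((0 : ℝ), (1 : ℝ)) := funext hB
  set B : ℝ × ℝ → ℝ := fun z => fderiv ℝ F z ((0 : ℝ), (1 : ℝ))
  have hF1 : ContDiffOn ℝ 1 (fderiv ℝ F) U := hF.fderiv_of_isOpen hU (by norm_num)
  have hB1 : ContDiffOn ℝ 1 B U := hF1.clm_apply contDiffOn_const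
  have hAc : ContinuousOn (fun z => fderiv ℝ F z ((1 : ℝ), (0 : ℝ))) U :=
    hF1.continuousOn.clm_apply continuousOn_const
  have hCc : ContinuousOn (fun z => fderiv ℝ B z ((0 : ℝ), (1 : ℝ))) U :=
    (hB1.continuousOn_fderiv_of_isOpen hU le_rfl).clm_apply continuousOn_const
  have hK : IsCompact ((fun t => (t, X t)) '' Icc (0 : ℝ) T) :=
    isCompact_Icc.image_of_continuousOn (continuousOn_id.prodMk hXc)
  have hKU : (fun t => (t, X t)) '' Icc (0 : ℝ) T ⊆ U := by
    rintro _ ⟨t, ht, rfl⟩; exact hpath t ht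
  obtain ⟨r₀, hr₀, hsub⟩ := hK.exists_thickening_subset_open hU hKU
  have hunif : ∀ f : ℝ × ℝ → ℝ, ContinuousOn f U → ∃ r > 0, ∀ t ∈ Icc (0 : ℝ) T, ∀ z,
      dist (t, X t) z < r → |f z - f (t, X t)| ≤ ε := fun f hf => by
    have := hK.uniformContinuousAt_of_continuousAt f
      (fun z hz => hf.continuousAt (hU.mem_nhds (hKU hz))) (Metric.dist_mem_uniformity hε)
    obtain ⟨r, hr, h⟩ := Metric.mem_uniformity_dist.1 this
    refine ⟨r, hr, fun t ht z hz => ?_⟩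
    have h' : dist (f (t, X t)) (f z) < ε := h hz (mem_image_of_mem _ ht)
    rw [dist_comm, Real.dist_eq] at h'
    exact h'.le
  obtain ⟨r₁, hr₁, hA⟩ := hunif _ hAc
  obtain ⟨r₂, hr₂, hC⟩ := hunif _ hCc
  set r := min r₀ (min r₁ r₂) with hr
  have hr0 : 0 < r := by positivity
  obtain ⟨δ, hδ, hXδ⟩ := Metric.uniformContinuousOn_iff.1
    (isCompact_Icc.uniformContinuousOn_of_continuous hXc) r hr0
  refine ⟨min δ r, by positivity, fun u hu v hv huv hlt => ?_⟩
  have hX : |X v - X u| < r := by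
    rw [← Real.dist_eq]
    refine hXδ v hv u hu ?_
    rw [Real.dist_eq, abs_of_nonneg (by linarith)]
    exact hlt.trans_le (min_le_left _ _)
  have hbox : ∀ t ∈ uIcc u v, ∀ s ∈ uIcc (X u) (X v), dist (u, X u) (t, s) < r :=
    fun t ht s hs => by
      rw [dist_comm, Prod.dist_eq]
      refine max_lt ?_ ?_
      · rw [Real.dist_eq]
        refine (abs_sub_left_of_mem_uIcc ht).trans_lt ?_
        rw [abs_of_nonneg (by linarith)]
        exact hlt.trans_le (min_le_right _ _)
      · rw [Real.dist_eq]
        exact (abs_sub_left_of_mem_uIcc hs).trans_lt hX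
  have hboxU : ∀ t ∈ uIcc u v, ∀ s ∈ uIcc (X u) (X v), (t, s) ∈ U := fun t ht s hs =>
    hsub (Metric.mem_thickening_iff.2 ⟨(u, X u), mem_image_of_mem _ hu, by
      rw [dist_comm]; exact (hbox t ht s hs).trans_le (min_le_left _ _)⟩)
  have := abs_taylor_time_space_le (F := F) (B := B) (u := u) (v := v) (x := X u) (y := X v)
    (A := fderiv ℝ F (u, X u) ((1 : ℝ), (0 : ℝ)))
    (C := fderiv ℝ B (u, X u) ((0 : ℝ), (1 : ℝ))) (ε := ε)
    (fun t ht s hs => (hF.contDiffAt (hU.mem_nhds (hboxU t ht s hs))).differentiableAt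
      (by norm_num)) (fun _ => rfl)
    (fun t ht s hs => (hB1.contDiffAt (hU.mem_nhds (hboxU t ht s hs))).differentiableAt
      (by norm_num))
    (fun t ht s hs => hA u hu _ ((hbox t ht s hs).trans_le
      ((min_le_right _ _).trans (min_le_left _ _))))
    (fun t ht s hs => hC u hu _ ((hbox t ht s hs).trans_le
      ((min_le_right _ _).trans (min_le_right _ _))))
  rwa [abs_of_nonneg (by linarith : 0 ≤ v - u)] at this

/-- Left-endpoint rectangles approximate the integral over short intervals uniformly. -/
lemma exists_integral_sub_rectangle_le {T : ℝ} {q : ℝ → ℝ} (hq : ContinuousOn q (Icc 0 T))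
    {ε : ℝ} (hε : 0 < ε) :
    ∃ δ > 0, ∀ u ∈ Icc (0 : ℝ) T, ∀ v ∈ Icc (0 : ℝ) T, u ≤ v → v - u < δ →
      |(∫ s in u..v, q s) - q u * (v - u)| ≤ ε * (v - u) := by
  obtain ⟨δ, hδ, hqδ⟩ := Metric.uniformContinuousOn_iff.1
    (isCompact_Icc.uniformContinuousOn_of_continuous hq) ε hε
  refine ⟨δ, hδ, fun u hu v hv huv hlt => ?_⟩
  have hint : IntervalIntegrable q MeasureTheory.volume u v := by
    refine (hq.mono ?_).intervalIntegrable
    rw [uIcc_of_le huv]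
    exact Icc_subset_Icc hu.1 hv.2
  have heq : (∫ s in u..v, q s) - q u * (v - u) = ∫ s in u..v, (q s - q u) := by
    rw [intervalIntegral.integral_sub hint intervalIntegrable_const,
      intervalIntegral.integral_const, smul_eq_mul, mul_comm]
  rw [heq, ← abs_of_nonneg (by linarith : 0 ≤ v - u), ← Real.norm_eq_abs (∫ s in u..v, _)]
  refine intervalIntegral.norm_integral_le_of_norm_le_const fun s hs => ?_
  rw [uIoc_of_le huv] at hs
  rw [← dist_eq_norm]
  refine (hqδ s ⟨hu.1.trans hs.1.le, hs.2.trans hv.2⟩ u hu ?_).le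
  rw [Real.dist_eq, abs_of_nonneg (by linarith [hs.1])]
  linarith [hs.2]

/-- Delta hedging replicates European options in the Black–Scholes model, pathwise:
if the realized quadratic variation of the path is `∫_0^t σ² X_s² ds` and `F` solves the
Black–Scholes PDE with zero interest rate, the discrete delta-hedging gains converge to
`F(T, X_T) - F(0, X_0)`. -/
theorem delta_hedging_black_scholes
    (T : ℝ) (hT : 0 < T) (σ : ℝ) (hσ : 0 < σ) (π : PartitionSeq T)
    (X : ℝ → ℝ) (hXc : ContinuousOn X (Set.Icc 0 T))
    -- the quadratic variation of `X` along `π` is `∫_0^t σ² X_s² ds`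
    (hQV : ∀ t ∈ Set.Icc (0 : ℝ) T,
      Tendsto (fun N => ∑ i ∈ (Finset.range (π.c N)).filter (fun i => π.t N i ≤ t),
          (X (π.t N (i + 1)) - X (π.t N i)) ^ 2)
        atTop (nhds (∫ s in (0 : ℝ)..t, σ ^ 2 * (X s) ^ 2)))
    (F : ℝ × ℝ → ℝ)
    -- `F` is three times continuously differentiable on a neighbourhood of the path
    (U : Set (ℝ × ℝ)) (hU : IsOpen U)
    (hpath : ∀ t ∈ Set.Icc (0 : ℝ) T, (t, X t) ∈ U)
    (hF : ContDiffOn ℝ 3 F U)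
    -- the Black–Scholes PDE with zero interest rate, on the neighbourhood
    (hBS : ∀ z ∈ U,
      fderiv ℝ F z ((1 : ℝ), (0 : ℝ)) +
        (1 / 2) * σ ^ 2 * z.2 ^ 2 *
          fderiv ℝ (fun w => fderiv ℝ F w ((0 : ℝ), (1 : ℝ))) z ((0 : ℝ), (1 : ℝ)) = 0) :
    Tendsto (fun N => ∑ k ∈ Finset.range (π.c N),
        fderiv ℝ F (π.t N k, X (π.t N k)) ((0 : ℝ), (1 : ℝ)) *
          (X (π.t N (k + 1)) - X (π.t N k)))
      atTop (nhds (F (T, X T) - F (0, X 0))) := by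
  set B : ℝ × ℝ → ℝ := fun w => fderiv ℝ F w ((0 : ℝ), (1 : ℝ)) with hB
  set q : ℝ → ℝ := fun s => σ ^ 2 * (X s) ^ 2 with hq
  set g : ℝ → ℝ := fun t => fderiv ℝ B (t, X t) ((0 : ℝ), (1 : ℝ)) with hg
  set Q : ℝ → ℝ := fun t => ∫ s in (0 : ℝ)..t, q s with hQ
  have hqc : ContinuousOn q (Icc 0 T) := continuousOn_const.mul (hXc.pow 2)
  have hqi : ∀ u ∈ Icc (0 : ℝ) T, ∀ v ∈ Icc (0 : ℝ) T,
      IntervalIntegrable q MeasureTheory.volume u v := fun u hu v hv =>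
    (hqc.mono (uIcc_subset_Icc hu hv)).intervalIntegrable
  have h0 : (0 : ℝ) ∈ Icc (0 : ℝ) T := left_mem_Icc.2 hT.le
  have hQsub : ∀ u ∈ Icc (0 : ℝ) T, ∀ v ∈ Icc (0 : ℝ) T, Q v - Q u = ∫ s in u..v, q s :=
    fun u hu v hv => intervalIntegral.integral_interval_sub_left (hqi 0 h0 v hv) (hqi 0 h0 u hu)
  have hQmono : ∀ u ∈ Icc (0 : ℝ) T, ∀ v ∈ Icc (0 : ℝ) T, u ≤ v → 0 ≤ Q v - Q u :=
    fun u hu v hv huv => by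
      rw [hQsub u hu v hv]
      exact intervalIntegral.integral_nonneg huv fun s _ => by positivity
  have hQc : ContinuousOn Q (Icc 0 T) := by
    rw [← uIcc_of_le hT.le]
    refine intervalIntegral.continuousOn_primitive_interval ?_
    rw [uIcc_of_le hT.le]
    exact hqc.integrableOn_Icc
  have hQ0 : Q 0 = 0 := intervalIntegral.integral_same
  have hgc : ContinuousOn g (Icc 0 T) := by
    have hB2 : ContDiffOn ℝ 2 B U :=
      (hF.fderiv_of_isOpen hU (by norm_num)).clm_apply contDiffOn_const
    exact ((hB2.continuousOn_fderiv_of_isOpen hU (by norm_num)).clm_apply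
      continuousOn_const).comp (continuousOn_id.prodMk hXc) hpath
  have hQVT : Tendsto (fun N => ∑ i ∈ Finset.range (π.c N),
      (X (π.t N (i + 1)) - X (π.t N i)) ^ 2) atTop (𝓝 (Q T)) := by
    refine (hQV T (right_mem_Icc.2 hT.le)).congr fun N => ?_
    rw [Finset.filter_true_of_mem fun i hi => (π.t_mem (Finset.mem_range.1 hi).le).2]
  have hQVbdd := hQVT.eventually_le_const (lt_add_one (Q T))
  have htaylor := π.tendsto_sum_of_le_mul
    (fun ε hε => exists_taylor_along_path hXc hU hpath (hF.of_le (by norm_num)) (B := B)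
      (fun _ => rfl) hε)
    (w := fun u v => (v - u) + (X v - X u) ^ 2) (K := T + (Q T + 1)) (by
      filter_upwards [hQVbdd] with N hN
      rw [Finset.sum_add_distrib, π.sum_range_sub N (fun t => t)]
      linarith)
  have hweak := π.tendsto_sum_mul_of_tendsto_sum_filter hT
    (a := fun N i => (X (π.t N (i + 1)) - X (π.t N i)) ^ 2 -
      (Q (π.t N (i + 1)) - Q (π.t N i))) (K := (Q T + 1) + Q T)
    (fun t ht => by
      have := (hQV t ht).sub (π.tendsto_sum_filter_sub hQc ht)
      simp only [← Finset.sum_sub_distrib] at this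
      rw [hQ0, sub_zero, sub_self] at this
      exact this)
    (by
      filter_upwards [hQVbdd] with N hN
      calc _ ≤ ∑ i ∈ Finset.range (π.c N), ((X (π.t N (i + 1)) - X (π.t N i)) ^ 2 +
            (Q (π.t N (i + 1)) - Q (π.t N i))) := by
            refine Finset.sum_le_sum fun i hi => ?_
            have hi := Finset.mem_range.1 hi
            have := hQmono _ (π.t_mem hi.le) _ (π.t_mem hi) (π.mono N i hi).le
            have := sq_nonneg (X (π.t N (i + 1)) - X (π.t N i))
            rw [abs_le]
            constructor <;> linarith
        _ ≤ (Q T + 1) + Q T := by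
            rw [Finset.sum_add_distrib, π.sum_range_sub N Q]
            linarith)
    hgc
  obtain ⟨M, hM⟩ := isCompact_Icc.exists_bound_of_continuousOn hgc
  have hM0 : 0 ≤ M := (norm_nonneg _).trans (hM 0 h0)
  have hriemann := π.tendsto_sum_of_le_mul
    (r := fun u v => g u * ((∫ s in u..v, q s) - q u * (v - u))) (w := fun u v => v - u) (K := T)
    (fun ε hε => by
      obtain ⟨δ, hδ, h⟩ := exists_integral_sub_rectangle_le hqc
        (show 0 < ε / (M + 1) by positivity)
      refine ⟨δ, hδ, fun u hu v hv huv hlt => ?_⟩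
      rw [abs_mul]
      calc |g u| * |(∫ s in u..v, q s) - q u * (v - u)|
          ≤ (M + 1) * (ε / (M + 1) * (v - u)) :=
            mul_le_mul ((hM u hu).trans (by linarith)) (h u hu v hv huv hlt)
              (abs_nonneg _) (by positivity)
        _ = ε * (v - u) := by field_simp)
    (Eventually.of_forall fun N => by rw [π.sum_range_sub N (fun t => t), sub_zero])
  have hmain := ((htaylor.const_sub (F (T, X T) - F (0, X 0))).sub
    (hweak.const_mul (1 / 2))).sub (hriemann.const_mul (1 / 2))
  simp only [mul_zero, sub_zero] at hmain
  refine hmain.congr fun N => ?_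
  rw [← π.sum_range_sub N (fun t => F (t, X t)), Finset.mul_sum, Finset.mul_sum,
    ← Finset.sum_sub_distrib, ← Finset.sum_sub_distrib, ← Finset.sum_sub_distrib]
  refine Finset.sum_congr rfl fun i hi => ?_
  have hi := Finset.mem_range.1 hi
  have hPDE := hBS _ (hpath _ (π.t_mem hi.le))
  rw [hQsub _ (π.t_mem hi.le) _ (π.t_mem hi)]
  simp only [hg, hq]
  linear_combination (π.t N (i + 1) - π.t N i) * hPDE
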